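/- arXiv:1312.2819 — 7 statements merged into one kernel-verified Lean document; each statement's English description precedes it below -/
import Mathlib

section
/- For every integer n ≥ 2, the minimum cardinality of a guarding set of the complete graph K_n is exactly n − 1. That is: (i) there exists a set S of n − 1 edges of K_n such that every acyclic orientation of K_n has a flippable edge in S (for example, all edges incident to one fixed vertex), and (ii) no set of at most n − 2 edges has this property. -/
/-- An orientation of a simple graph `G`: a choice, for each edge, of exactly one
of its two directions. -/
structure GraphOrientation {V : Type*} (G : SimpleGraph V) where
  /-- `dir u v` means the edge `uv` is oriented from `u` to `v`. -/
  dir : V → V → Prop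
  dir_adj : ∀ u v, dir u v → G.Adj u v
  dir_total : ∀ u v, G.Adj u v → dir u v ∨ dir v u
  dir_asymm : ∀ u v, dir u v → ¬ dir v u

/-- An orientation is acyclic if it has no directed cycle. -/
def GraphOrientation.IsAcyclic {V : Type*} {G : SimpleGraph V} (O : GraphOrientation G) : Prop :=
  ∀ v, ¬ Relation.TransGen O.dir v v

/-- The directed-edge relation obtained from `O` by reversing the edge directed
from `u` to `v`. -/
def GraphOrientation.flip {V : Type*} {G : SimpleGraph V} (O : GraphOrientation G)
    (u v : V) : V → V → Prop :=
  fun a b => (O.dir a b ∧ ¬(a = u ∧ b = v)) ∨ (a = v ∧ b = u)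

/-- The edge directed from `u` to `v` is flippable if reversing it again yields
an acyclic orientation. -/
def GraphOrientation.Flippable {V : Type*} {G : SimpleGraph V} (O : GraphOrientation G)
    (u v : V) : Prop :=
  O.dir u v ∧ ∀ w, ¬ Relation.TransGen (O.flip u v) w w

/-- A set `S` of edges of `G` is a guarding set if every acyclic orientation of `G`
has a flippable edge belonging to `S`. -/
def SimpleGraph.IsGuarding {V : Type*} (G : SimpleGraph V) (S : Set (Sym2 V)) : Prop :=
  ∀ O : GraphOrientation G, O.IsAcyclic → ∃ u v, O.Flippable u v ∧ s(u, v) ∈ S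

open Finset in
/-- Removing a vertex `w` lowers the sum of the degrees by twice the degree of `w`. -/
theorem sum_card_filter_erase {V : Type*} [DecidableEq V] (r : V → V → Prop) [DecidableRel r]
    (hsymm : ∀ a b, r a b → r b a) (hirr : ∀ a, ¬ r a a) (A : Finset V) {w : V} (hw : w ∈ A) :
    ∑ v ∈ A.erase w, #{x ∈ A.erase w | r v x} + 2 * #{x ∈ A | r w x} =
      ∑ v ∈ A, #{x ∈ A | r v x} := by
  have hdeg (v : V) : #{x ∈ A | r v x} = #{x ∈ A.erase w | r v x} + if r v w then 1 else 0 := by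
    simp only [card_filter]
    exact (sum_erase_add A _ hw).symm
  have hw' : #{x ∈ A | r w x} = ∑ v ∈ A.erase w, if r v w then 1 else 0 := by
    rw [hdeg w, if_neg (hirr w), add_zero, card_filter]
    refine sum_congr rfl fun v _ => ?_
    simp only [show r w v ↔ r v w from ⟨hsymm _ _, hsymm _ _⟩]
  have hsum : ∑ v ∈ A.erase w, #{x ∈ A | r v x} =
      ∑ v ∈ A.erase w, #{x ∈ A.erase w | r v x} + ∑ v ∈ A.erase w, if r v w then 1 else 0 := by
    rw [← sum_add_distrib]
    exact sum_congr rfl fun v _ => hdeg v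
  rw [← sum_erase_add A _ hw, hsum, ← hw']
  ring

open Finset in
/-- If a graph `r` on `A` has at most `#A - 2` edges, its complement has a Hamiltonian path. -/
theorem exists_hamiltonian_list_avoiding {V : Type*} [DecidableEq V] (r : V → V → Prop)
    [DecidableRel r] (hsymm : ∀ a b, r a b → r b a) (hirr : ∀ a, ¬ r a a) (A : Finset V)
    (hA : ∑ v ∈ A, #{x ∈ A | r v x} + 4 ≤ 2 * #A) :
    ∃ l : List V, l.Nodup ∧ (∀ x, x ∈ l ↔ x ∈ A) ∧ l.IsChain (fun a b => ¬ r a b) := by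
  induction A using Finset.strongInduction with
  | H A ih =>
  by_cases h1 : ∃ w ∈ A, #{x ∈ A | r w x} = 1
  · obtain ⟨w, hw, hdeg⟩ := h1
    have hsum := sum_card_filter_erase r hsymm hirr A hw
    have hcard := card_erase_add_one hw
    obtain ⟨l, hnd, hmem, hch⟩ := ih (A.erase w) (erase_ssubset hw) (by omega)
    have hwl : w ∉ l := by simp [hmem]
    have hlen : 2 ≤ l.length := by
      have : l.toFinset = A.erase w := by ext; simp [hmem]
      rw [← List.toFinset_card_of_nodup hnd, this]
      omega
    have hne : l ≠ [] := by rintro rfl; simp at hlen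
    by_cases hhead : r w (l.head hne)
    · have hlast : ¬ r w (l.getLast hne) := by
        intro hlast
        obtain ⟨c, hc⟩ := card_eq_one.1 hdeg
        have key : ∀ x ∈ l, r w x → x = c := fun x hx hr => by
          have : x ∈ ({x ∈ A | r w x} : Finset V) :=
            mem_filter.2 ⟨mem_of_mem_erase ((hmem x).1 hx), hr⟩
          simpa [hc] using this
        have heq : l.head hne = l.getLast hne :=
          (key _ (List.head_mem hne) hhead).trans (key _ (List.getLast_mem hne) hlast).symm
        rw [List.head_eq_getElem, List.getLast_eq_getElem, hnd.getElem_inj_iff] at heq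
        omega
      refine ⟨l ++ [w], ?_, ?_, ?_⟩
      · rw [List.nodup_append]
        refine ⟨hnd, List.nodup_singleton w, fun a ha b hb => ?_⟩
        rintro rfl
        rw [List.mem_singleton] at hb
        exact hwl (hb ▸ ha)
      · intro x
        by_cases hx : x = w <;> simp [hmem, hx, hw]
      · rw [List.isChain_append]
        refine ⟨hch, List.isChain_singleton w, fun x hx y hy hr => hlast ?_⟩
        rw [List.getLast?_eq_some_getLast hne] at hx
        simp only [Option.mem_def, Option.some.injEq, List.head?_cons] at hx hy
        subst hx hy
        exact hsymm _ _ hr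
    · refine ⟨w :: l, List.nodup_cons.2 ⟨hwl, hnd⟩, ?_, ?_⟩
      · intro x
        by_cases hx : x = w <;> simp [hmem, hx, hw]
      · rw [List.isChain_cons]
        refine ⟨fun y hy => ?_, hch⟩
        rw [List.head?_eq_some_head hne] at hy
        simp only [Option.mem_def, Option.some.injEq] at hy
        exact hy ▸ hhead
  by_cases h2 : ∃ v ∈ A, 2 ≤ #{x ∈ A | r v x}
  · obtain ⟨v, hv, hdv⟩ := h2
    obtain ⟨w, hw, hdw⟩ : ∃ w ∈ A, #{x ∈ A | r w x} = 0 := by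
      by_contra! hcon
      have : ∑ v ∈ A, 2 ≤ ∑ v ∈ A, #{x ∈ A | r v x} := sum_le_sum fun x hx => by
        have := hcon x hx
        have : #{y ∈ A | r x y} ≠ 1 := fun h => h1 ⟨x, hx, h⟩
        omega
      simp only [sum_const, smul_eq_mul] at this
      omega
    have hvw : v ≠ w := by rintro rfl; omega
    have hwn : ∀ x ∈ A, ¬ r w x := by simpa [filter_eq_empty_iff] using hdw
    have hw' : w ∈ A.erase v := mem_erase.2 ⟨hvw.symm, hw⟩
    have hsum := sum_card_filter_erase r hsymm hirr A hv
    have hsum' := sum_card_filter_erase r hsymm hirr (A.erase v) hw'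
    have hcard := card_erase_add_one hv
    have hcard' := card_erase_add_one hw'
    obtain ⟨l, hnd, hmem, hch⟩ := ih ((A.erase v).erase w)
      ((erase_ssubset hw').trans (erase_ssubset hv)) (by omega)
    refine ⟨v :: w :: l, ?_, ?_, ?_⟩
    · simp [hmem, hnd, hvw]
    · intro x
      by_cases hx : x = w <;> by_cases hx' : x = v <;> simp [hmem, hx, hx', hw, hv]
    · rw [List.isChain_cons_cons, List.isChain_cons]
      refine ⟨fun h => hwn v hv (hsymm _ _ h), fun y hy => hwn y ?_, hch⟩
      have := (hmem y).1 (List.mem_of_mem_head? hy)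
      exact mem_of_mem_erase (mem_of_mem_erase this)
  · refine ⟨A.toList, A.nodup_toList, fun x => mem_toList, List.Pairwise.isChain ?_⟩
    refine List.pairwise_of_forall_mem_list fun a ha b hb hr => ?_
    rw [mem_toList] at ha hb
    have hpos : 0 < #{x ∈ A | r a x} := card_pos.2 ⟨b, mem_filter.2 ⟨hb, hr⟩⟩
    have : #{x ∈ A | r a x} ≠ 1 := fun h => h1 ⟨a, ha, h⟩
    exact h2 ⟨a, ha, by omega⟩

namespace GraphOrientation

variable {V : Type*}

theorem IsAcyclic.trans {O : GraphOrientation (⊤ : SimpleGraph V)} (hO : O.IsAcyclic) {a b c : V}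
    (hab : O.dir a b) (hbc : O.dir b c) : O.dir a c := by
  have hac : a ≠ c := by
    rintro rfl
    exact O.dir_asymm _ _ hab hbc
  refine (O.dir_total a c hac).resolve_right fun hca => hO a ?_
  exact .head hab (.head hbc (.single hca))

theorem irrefl {G : SimpleGraph V} (O : GraphOrientation G) (a : V) : ¬ O.dir a a :=
  fun h => O.dir_asymm a a h h

/-- In an acyclic tournament, an edge which is a covering pair is flippable. -/
theorem IsAcyclic.flippable_of_forall {O : GraphOrientation (⊤ : SimpleGraph V)}
    (hO : O.IsAcyclic) {u v : V} (huv : O.dir u v) (h : ∀ x, O.dir u x → ¬ O.dir x v) :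
    O.Flippable u v := by
  have hne : u ≠ v := by
    rintro rfl
    exact O.irrefl _ huv
  have htrans : ∀ a b c, O.flip u v a b → O.flip u v b c → O.flip u v a c := by
    rintro a b c (⟨hab, hab'⟩ | ⟨rfl, rfl⟩) (⟨hbc, hbc'⟩ | ⟨rfl, rfl⟩)
    · refine .inl ⟨hO.trans hab hbc, ?_⟩
      rintro ⟨rfl, rfl⟩
      exact h _ hab hbc
    · have hac : a ≠ c := fun e => hab' ⟨e, rfl⟩
      refine .inl ⟨(O.dir_total a c hac).resolve_right fun hca => h a hca hab, ?_⟩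
      exact fun e => hac e.1
    · have hac : a ≠ c := fun e => hbc' ⟨rfl, e.symm⟩
      refine .inl ⟨(O.dir_total a c hac).resolve_right fun hca => h c hbc hca, ?_⟩
      exact fun e => hne e.1.symm
    · exact absurd rfl hne
  have : IsTrans V (O.flip u v) := ⟨htrans⟩
  refine ⟨huv, fun w hw => ?_⟩
  rw [Relation.transGen_eq_self] at hw
  rcases hw with ⟨hw, -⟩ | ⟨rfl, rfl⟩
  · exact O.irrefl _ hw
  · exact hne rfl

/-- In an acyclic tournament, every vertex is incident to a flippable edge. -/
theorem IsAcyclic.exists_flippable_incident [Finite V] [Nontrivial V]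
    {O : GraphOrientation (⊤ : SimpleGraph V)} (hO : O.IsAcyclic) (z : V) :
    ∃ w, O.Flippable z w ∨ O.Flippable w z := by
  have : IsTrans V O.dir := ⟨fun _ _ _ => hO.trans⟩
  have : Std.Irrefl O.dir := ⟨O.irrefl⟩
  obtain ⟨y, hy⟩ := exists_ne z
  rcases O.dir_total z y hy.symm with hzy | hyz
  · obtain ⟨m, hm, hmin⟩ :=
      (Finite.wellFounded_of_trans_of_irrefl O.dir).has_min {x | O.dir z x} ⟨y, hzy⟩
    exact ⟨m, .inl (hO.flippable_of_forall hm hmin)⟩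
  · obtain ⟨m, hm, hmax⟩ :=
      (Finite.wellFounded_of_trans_of_irrefl (Function.swap O.dir)).has_min {x | O.dir x z}
        ⟨y, hyz⟩
    exact ⟨m, .inr (hO.flippable_of_forall hm fun x hmx hxz => hmax x hxz hmx)⟩

/-- The orientation of the complete graph along an injective labelling of the vertices. -/
def ofInjective (f : V → ℕ) (hf : Function.Injective f) :
    GraphOrientation (⊤ : SimpleGraph V) where
  dir a b := f a < f b
  dir_adj a b h := by
    rintro rfl
    exact lt_irrefl _ h
  dir_total a b h := lt_or_gt_of_ne fun e => h (hf e)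
  dir_asymm _ _ h := h.asymm

theorem ofInjective_isAcyclic (f : V → ℕ) (hf : Function.Injective f) :
    (ofInjective f hf).IsAcyclic := by
  have : IsTrans V (ofInjective f hf).dir := ⟨fun _ _ _ => lt_trans⟩
  intro v hv
  rw [Relation.transGen_eq_self] at hv
  exact lt_irrefl _ hv

/-- A directed edge on a two-step detour is not flippable. -/
theorem Flippable.not_dir {G : SimpleGraph V} {O : GraphOrientation G} {u v x : V}
    (h : O.Flippable u v) (hux : O.dir u x) : ¬ O.dir x v := by
  intro hxv
  refine h.2 u (.head (.inl ⟨hux, ?_⟩) (.head (.inl ⟨hxv, ?_⟩) (.single (.inr ⟨rfl, rfl⟩))))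
  · rintro ⟨-, rfl⟩
    exact O.irrefl _ hxv
  · rintro ⟨rfl, -⟩
    exact O.irrefl _ hux

end GraphOrientation

/-- A guarding set of a complete graph meets every Hamiltonian path. -/
theorem SimpleGraph.IsGuarding.not_isChain {V : Type*} [DecidableEq V] {S : Set (Sym2 V)}
    (hS : (⊤ : SimpleGraph V).IsGuarding S) {l : List V} (hl : ∀ x, x ∈ l) (hnd : l.Nodup) :
    ¬ l.IsChain (fun a b => s(a, b) ∉ S) := by
  intro hch
  have hinj : Function.Injective fun x => l.idxOf x := fun a b h => (List.idxOf_inj (hl a)).1 h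
  obtain ⟨u, v, hflip, hmem⟩ := hS _ (GraphOrientation.ofInjective_isAcyclic _ hinj)
  have huv : l.idxOf u < l.idxOf v := hflip.1
  have hv : l.idxOf v < l.length := List.idxOf_lt_length_of_mem (hl v)
  have hsucc : l.idxOf v = l.idxOf u + 1 := by
    by_contra hne
    have hidx := hnd.idxOf_getElem (l.idxOf u + 1) (by omega)
    refine hflip.not_dir (x := l[l.idxOf u + 1]) ?_ ?_
    · change l.idxOf u < l.idxOf _
      omega
    · change l.idxOf _ < l.idxOf v
      omega
  have := List.isChain_iff_getElem.1 hch (l.idxOf u) (by omega)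
  simp only [← hsucc, List.getElem_idxOf] at this
  exact this hmem

open Finset in
/-- A guarding set of a complete graph on `n ≥ 2` vertices has at least `n - 1` elements. -/
theorem SimpleGraph.IsGuarding.card_le {V : Type*} [Fintype V] [DecidableEq V]
    {S : Finset (Sym2 V)} (hV : 2 ≤ Fintype.card V)
    (hS : (⊤ : SimpleGraph V).IsGuarding (S : Set (Sym2 V)))
    (hdiag : (S : Set (Sym2 V)) ⊆ (⊤ : SimpleGraph V).edgeSet) :
    Fintype.card V - 1 ≤ #S := by
  classical
  by_contra! hlt
  obtain ⟨G, hG⟩ : ∃ G, G = SimpleGraph.fromEdgeSet (S : Set (Sym2 V)) := ⟨_, rfl⟩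
  have hE : G.edgeFinset ⊆ S := fun e he => by
    rw [SimpleGraph.mem_edgeFinset, hG, SimpleGraph.edgeSet_fromEdgeSet] at he
    exact he.1
  have hcard := card_le_card hE
  have hsum := G.sum_degrees_eq_twice_card_edges
  have hdeg (v : V) : #{x | G.Adj v x} = G.degree v := by
    rw [← SimpleGraph.card_neighborFinset_eq_degree, SimpleGraph.neighborFinset_eq_filter]
  obtain ⟨l, hnd, hmem, hch⟩ := exists_hamiltonian_list_avoiding G.Adj (fun _ _ h => h.symm)
    (fun a => G.irrefl) univ (by simp only [hdeg, hsum, card_univ]; omega)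
  refine hS.not_isChain (fun x => (hmem x).2 (mem_univ x)) hnd (hch.imp fun a b hab hs => hab ?_)
  rw [hG]
  exact (SimpleGraph.fromEdgeSet_adj _).2 ⟨hs, hdiag hs⟩

/-- For every `n ≥ 2`, the minimum cardinality of a guarding set of the complete graph
`K_n` is exactly `n - 1`: some guarding set of `n - 1` edges exists, and no guarding set
has fewer than `n - 1` edges. -/
theorem min_guarding_complete_graph (n : ℕ) (hn : 2 ≤ n) :
    IsLeast {k : ℕ | ∃ S : Finset (Sym2 (Fin n)),
        ↑S ⊆ (⊤ : SimpleGraph (Fin n)).edgeSet ∧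
        (⊤ : SimpleGraph (Fin n)).IsGuarding ↑S ∧ S.card = k}
      (n - 1) := by
  refine ⟨⟨(Finset.univ.erase ⟨0, by omega⟩).image (fun w => s(⟨0, by omega⟩, w)), ?_, ?_, ?_⟩, ?_⟩
  · intro e he
    simp only [Finset.coe_image, Set.mem_image, Finset.mem_coe, Finset.mem_erase] at he
    obtain ⟨w, ⟨hw, -⟩, rfl⟩ := he
    exact hw.symm
  · intro O hO
    have : Nontrivial (Fin n) := Fin.nontrivial_iff_two_le.2 hn
    have hmem (w : Fin n) (hw : w ≠ ⟨0, by omega⟩) : s(⟨0, by omega⟩, w) ∈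
        (Finset.univ.erase ⟨0, by omega⟩).image (fun w : Fin n => s(⟨0, by omega⟩, w)) :=
      Finset.mem_image_of_mem _ (Finset.mem_erase.2 ⟨hw, Finset.mem_univ w⟩)
    obtain ⟨w, hw | hw⟩ := hO.exists_flippable_incident ⟨0, by omega⟩
    · exact ⟨_, w, hw, hmem w (O.dir_adj _ _ hw.1).ne'⟩
    · refine ⟨w, _, hw, ?_⟩
      rw [Sym2.eq_swap]
      exact hmem w (O.dir_adj _ _ hw.1).ne
  · rw [Finset.card_image_of_injective _ fun a b h => Sym2.congr_right.1 h]
    simp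
  · rintro k ⟨S, hsub, hS, rfl⟩
    simpa using hS.card_le (by simpa using hn) hsub
end

section
/- Every simple graph on n ≥ 2 vertices having at least C(n,2) − (n − 2) edges (i.e., missing at most n − 2 edges from the complete graph) contains a Hamiltonian path. -/
/-- If no two consecutive entries `a, b` of `l` satisfy `P a` and `Q b`, and the last entry does
not satisfy `P`, then the entries satisfying `P` and the non-initial entries satisfying `Q`
together number less than the length of `l`. -/
theorem List.countP_add_countP_tail_le {α : Type*} (P Q : α → Bool) (l : List α)
    (hl : l.IsChain (fun a b => ¬(P a ∧ Q b))) (hlast : ∀ x ∈ l.getLast?, ¬ P x) :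
    l.countP P + l.tail.countP Q ≤ l.tail.length := by
  induction l with
  | nil => simp
  | cons a t ih =>
    cases t with
    | nil => simpa using hlast
    | cons b s =>
      rw [List.isChain_cons_cons] at hl
      have := ih hl.2 (by simpa using hlast)
      have hab := hl.1
      rw [List.countP_cons (a := a)]
      simp only [List.tail_cons, List.length_cons] at this ⊢
      rw [List.countP_cons (p := Q)]
      split_ifs <;> first | omega | tauto

namespace SimpleGraph

variable {V : Type*} {G : SimpleGraph V}

/-- If `w` is adjacent to `a` and the head of a path is adjacent to the successor `b` of `a`,
then the path can be rerouted to start at `w`. -/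
theorem isChain_adj_cons_reverse_append {w a b : V} {l₁ l₂ : List V}
    (hl : (l₁ ++ a :: b :: l₂).IsChain G.Adj) (hwa : G.Adj w a)
    (hb : ∀ x ∈ (l₁ ++ a :: b :: l₂).head?, G.Adj x b) :
    (w :: ((l₁ ++ [a]).reverse ++ b :: l₂)).IsChain G.Adj := by
  rw [List.isChain_append_cons_cons] at hl
  have hrev : (l₁ ++ [a]).reverse.IsChain G.Adj := by
    rw [List.isChain_reverse]
    exact hl.1.imp fun _ _ h => h.symm
  refine List.isChain_cons.2 ⟨by simpa using hwa, List.isChain_append.2 ⟨hrev, hl.2.2, ?_⟩⟩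
  intro x hx y hy
  obtain rfl : b = y := by simpa using hy
  apply hb
  rw [List.getLast?_reverse] at hx
  cases l₁ <;> simpa using hx

/-- In a graph with a longest path missing a vertex `w`, the degrees of `w` and of the
(nonadjacent) head of the path sum to at most `|V| - 2`. -/
theorem degree_add_degree_add_two_le_of_longest [Fintype V] [DecidableEq V] [DecidableRel G.Adj]
    {v w : V} {t : List V} (hchain : (v :: t).IsChain G.Adj) (hnodup : (v :: t).Nodup)
    (hmax : ∀ l : List V, l.IsChain G.Adj → l.Nodup → l.length ≤ (v :: t).length)
    (hw : w ∉ v :: t) :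
    G.degree v + G.degree w + 2 ≤ Fintype.card V := by
  have head_nonadj : ∀ x, x ∉ v :: t → ¬ G.Adj v x := by
    intro x hx hadj
    have := hmax (x :: v :: t) (List.isChain_cons_cons.2 ⟨hadj.symm, hchain⟩)
      (List.nodup_cons.2 ⟨hx, hnodup⟩)
    simp at this
  have hcount := List.countP_add_countP_tail_le (fun x => decide (G.Adj w x))
    (fun x => decide (G.Adj v x)) (v :: t) (by
      rw [List.isChain_iff_forall_rel_of_append_cons_cons]
      rintro a b l₁ l₂ heq ⟨hwa, hvb⟩
      rw [decide_eq_true_eq] at hwa hvb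
      have hperm : (w :: ((l₁ ++ [a]).reverse ++ b :: l₂)).Perm (w :: v :: t) := by
        rw [heq]
        refine List.Perm.cons _ (((List.reverse_perm _).append_right _).trans ?_)
        simp
      have := hmax _ (isChain_adj_cons_reverse_append (heq ▸ hchain) hwa
        (by rw [← heq]; simpa using hvb))
        (hperm.nodup_iff.2 (List.nodup_cons.2 ⟨hw, hnodup⟩))
      rw [hperm.length_eq] at this
      simp at this)
    (by
      intro x hx hadj
      rw [decide_eq_true_eq] at hadj
      have := hmax ((v :: t) ++ [w]) (List.isChain_append.2 ⟨hchain, List.isChain_singleton _, by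
          intro y hy z hz
          obtain rfl : w = z := by simpa using hz
          obtain rfl : x = y := Option.mem_unique hx hy
          exact hadj.symm⟩)
        ((List.perm_append_singleton _ _).nodup_iff.2 (List.nodup_cons.2 ⟨hw, hnodup⟩))
      simp at this)
  have hv : G.degree v ≤ t.countP (fun x => decide (G.Adj v x)) := by
    rw [List.countP_eq_length_filter, ← card_neighborFinset_eq_degree]
    refine (Finset.card_le_card fun x hx => ?_).trans (List.toFinset_card_le _)
    rw [mem_neighborFinset] at hx
    have hmem : x ∈ v :: t := by
      by_contra h
      exact head_nonadj x h hx
    have := hx.ne'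
    simp_all
  have hwdeg : G.degree w ≤ (v :: t).countP (fun x => decide (G.Adj w x)) +
      (Finset.univ \ (w :: v :: t).toFinset).card := by
    rw [List.countP_eq_length_filter, ← card_neighborFinset_eq_degree]
    refine (Finset.card_le_card (t := ((v :: t).filter (fun x => decide (G.Adj w x))).toFinset ∪
      (Finset.univ \ (w :: v :: t).toFinset)) fun x hx => ?_).trans
      ((Finset.card_union_le _ _).trans (Nat.add_le_add_right (List.toFinset_card_le _) _))
    rw [mem_neighborFinset] at hx
    have := hx.ne'
    by_cases hmem : x ∈ v :: t
    · exact Finset.mem_union_left _ (by simpa [hx] using hmem)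
    · exact Finset.mem_union_right _ (by simp_all)
  have hcard : (Finset.univ \ (w :: v :: t).toFinset).card + (t.length + 2) = Fintype.card V := by
    have := Finset.card_sdiff_add_card_eq_card (Finset.subset_univ (w :: v :: t).toFinset)
    rw [List.toFinset_card_of_nodup (List.nodup_cons.2 ⟨hw, hnodup⟩)] at this
    simpa using this
  simp only [List.tail_cons] at hcount
  omega

/-- Ore's theorem for Hamiltonian paths. -/
theorem exists_isHamiltonian_of_card_le_degree_add_degree [Fintype V] [DecidableEq V] [Nonempty V]
    [DecidableRel G.Adj]
    (h : ∀ u w, u ≠ w → ¬ G.Adj u w → Fintype.card V ≤ G.degree u + G.degree w + 1) :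
    ∃ (u v : V) (p : G.Walk u v), p.IsHamiltonian := by
  let S : Set (List V) := {l | l.IsChain G.Adj ∧ l.Nodup}
  have hS : S.Finite := (List.finite_length_le V (Fintype.card V)).subset
    fun _ hl => hl.2.length_le_card
  obtain ⟨l, ⟨hchain, hnodup⟩, hmax⟩ := hS.exists_maximalFor List.length S ⟨[], by simp [S]⟩
  replace hmax : ∀ l' : List V, l'.IsChain G.Adj → l'.Nodup → l'.length ≤ l.length := by
    intro l' h₁ h₂
    exact (le_total _ _).elim id (hmax ⟨h₁, h₂⟩)
  obtain _ | ⟨v, t⟩ := l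
  · have := hmax [Classical.arbitrary V] (by simp) (by simp)
    simp at this
  have hall : ∀ w, w ∈ v :: t := by
    intro w
    by_contra hw
    have hdeg := degree_add_degree_add_two_le_of_longest hchain hnodup hmax hw
    have hadj : ¬ G.Adj v w := by
      intro hadj
      have := hmax (w :: v :: t) (List.isChain_cons_cons.2 ⟨hadj.symm, hchain⟩)
        (List.nodup_cons.2 ⟨hw, hnodup⟩)
      simp at this
    have := h v w (by rintro rfl; simp at hw) hadj
    omega
  refine ⟨_, _, Walk.ofSupport (v :: t) (by simp) hchain, fun a => ?_⟩
  rw [Walk.support_ofSupport]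
  exact List.count_eq_one_of_mem hnodup (hall a)

theorem degree_add_degree_le_card_edgeFinset_add_one [Fintype V] [DecidableEq V]
    [DecidableRel G.Adj] {u w : V} (huw : u ≠ w) :
    G.degree u + G.degree w ≤ G.edgeFinset.card + 1 := by
  rw [← card_incidenceFinset_eq_degree, ← card_incidenceFinset_eq_degree,
    ← Finset.card_union_add_card_inter]
  refine Nat.add_le_add (Finset.card_le_card
    (Finset.union_subset (G.incidenceFinset_subset u) (G.incidenceFinset_subset w))) ?_
  rw [← Finset.card_singleton s(u, w)]
  refine Finset.card_le_card fun e he => ?_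
  have := G.incidenceSet_inter_incidenceSet_subset huw (show e ∈ _ by simpa using he)
  simpa using this

theorem card_edgeFinset_add_card_edgeFinset_compl [Fintype V] [DecidableEq V]
    [DecidableRel G.Adj] :
    G.edgeFinset.card + Gᶜ.edgeFinset.card = (Fintype.card V).choose 2 := by
  rw [← card_edgeFinset_top_eq_card_choose_two,
    ← Finset.card_union_of_disjoint (disjoint_edgeFinset.2 disjoint_compl_right),
    ← edgeFinset_sup]
  congr 1
  ext e
  rw [mem_edgeFinset, mem_edgeFinset, sup_compl_eq_top]

end SimpleGraph

/-- Every simple graph on `n ≥ 2` vertices having at least `C(n,2) - (n - 2)` edges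
(i.e. missing at most `n - 2` edges from the complete graph) contains a Hamiltonian
path, i.e. a path walk visiting every vertex exactly once. -/
theorem hamiltonian_path_of_dense {V : Type*} [Fintype V] [DecidableEq V]
    (n : ℕ) (hn : 2 ≤ n) (hV : Fintype.card V = n)
    (G : SimpleGraph V) [DecidableRel G.Adj]
    (hE : n.choose 2 - (n - 2) ≤ G.edgeFinset.card) :
    ∃ (u v : V) (p : G.Walk u v), p.IsHamiltonian := by
  have : Nonempty V := Fintype.card_pos_iff.1 (by omega)
  refine SimpleGraph.exists_isHamiltonian_of_card_le_degree_add_degree fun u w huw _ => ?_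
  have hcompl := SimpleGraph.degree_add_degree_le_card_edgeFinset_add_one (G := Gᶜ) huw
  have hsum := SimpleGraph.card_edgeFinset_add_card_edgeFinset_compl (G := G)
  rw [SimpleGraph.degree_compl, SimpleGraph.degree_compl] at hcompl
  rw [hV] at hsum hcompl ⊢
  omega
end

section
/- Let G = (V,E) be a finite connected simple graph and let C ⊆ E be an edge cut of G, i.e., a set of edges whose removal disconnects G. Then C is a guarding set of G: every acyclic orientation of G has a flippable edge belonging to C. -/
namespace GraphOrientation

variable {V : Type*} {G : SimpleGraph V}

/-- The partial order on the vertices in which `u < v` when an acyclic orientation has a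
directed path from `u` to `v`. -/
@[reducible] def reachabilityOrder (O : GraphOrientation G) (hO : O.IsAcyclic) :
    PartialOrder V where
  le := Relation.ReflTransGen O.dir
  lt := Relation.TransGen O.dir
  le_refl _ := .refl
  le_trans _ _ _ := .trans
  lt_iff_le_not_ge u v :=
    ⟨fun h => ⟨h.to_reflTransGen, fun h' => hO u (h.trans_left h')⟩, fun ⟨h, h'⟩ => by
      rcases Relation.reflTransGen_iff_eq_or_transGen.1 h with rfl | h
      · exact absurd .refl h'
      · exact h⟩
  le_antisymm u v h h' := by
    rcases Relation.reflTransGen_iff_eq_or_transGen.1 h with rfl | h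
    · rfl
    · exact absurd (h.trans_left h') (hO u)

/-- Reversing a covering pair of a strict order does not create directed cycles. -/
theorem not_transGen_of_covBy [PartialOrder V] {r : V → V → Prop} {u v : V} (huv : u ⋖ v)
    (hr : ∀ a b, r a b → (a < b ∧ ¬(a = u ∧ b = v)) ∨ (a = v ∧ b = u)) (w : V) :
    ¬ Relation.TransGen r w w := by
  have := fun c => huv.eq_or_eq (c := c)
  let R : V → V → Prop := fun a b =>
    (a < b ∧ ¬(a = u ∧ b = v)) ∨ (a ≤ v ∧ a ≠ u ∧ u ≤ b ∧ b ≠ v)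
  have hR : ∀ a b, Relation.TransGen r a b → R a b := by
    intro a b hab
    have hstep : ∀ a b, r a b → R a b := fun a b h => by
      rcases hr a b h with h | ⟨rfl, rfl⟩
      · exact .inl h
      · exact .inr ⟨le_rfl, huv.lt.ne', le_rfl, huv.lt.ne⟩
    induction hab with
    | single h => exact hstep _ _ h
    | tail _ h ih =>
      have h := hstep _ _ h
      have := huv.lt
      grind
  have := hR w w
  grind

/-- The covering pairs of the reachability order are flippable edges. -/
theorem flippable_of_covBy (O : GraphOrientation G) (hO : O.IsAcyclic) {u v : V}
    (huv : letI := O.reachabilityOrder hO; u ⋖ v) : O.Flippable u v := by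
  let := O.reachabilityOrder hO
  refine ⟨?_, not_transGen_of_covBy huv fun a b => ?_⟩
  · rcases Relation.TransGen.tail'_iff.1 huv.lt with ⟨c, huc, hcv⟩
    rcases Relation.reflTransGen_iff_eq_or_transGen.1 huc with rfl | huc
    · exact hcv
    · exact absurd (Relation.TransGen.single hcv) (huv.2 huc)
  · exact Or.imp_left (And.imp_left .single)

end GraphOrientation

/-- Every edge cut of a finite connected simple graph `G` (a set of edges whose removal
disconnects the graph) is a guarding set of `G`: every acyclic orientation of `G` has a
flippable edge belonging to the cut. -/
theorem edgeCut_isGuarding {V : Type*} [Fintype V] (G : SimpleGraph V)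
    (hG : G.Connected) (C : Set (Sym2 V)) (hC : C ⊆ G.edgeSet)
    (hcut : ¬ (G.deleteEdges C).Connected) :
    G.IsGuarding C := by
  classical
  intro O hO
  by_contra! hflip
  refine hcut ((SimpleGraph.connected_iff _).2 ⟨?_, hG.nonempty⟩)
  have reach_of_dir : ∀ {a b}, O.dir a b → (G.deleteEdges C).Reachable a b := fun {a b} hab => by
    let := O.reachabilityOrder hO
    let := Fintype.toLocallyFiniteOrder (α := V)
    have hlt : a < b := Relation.TransGen.single hab
    rw [SimpleGraph.reachable_iff_reflTransGen]
    refine Relation.ReflTransGen.mono (fun x y hxy => ?_) _ _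
      (lt_iff_transGen_covBy.1 hlt).to_reflTransGen
    have hf := O.flippable_of_covBy hO hxy
    exact SimpleGraph.deleteEdges_adj.2 ⟨O.dir_adj _ _ hf.1, hflip _ _ hf⟩
  intro a b
  have hab := hG.preconnected a b
  rw [SimpleGraph.reachable_iff_reflTransGen] at hab
  induction hab with
  | refl => exact .refl a
  | tail _ hadj ih =>
    exact ih.trans ((O.dir_total _ _ hadj).elim reach_of_dir fun h => (reach_of_dir h).symm)
end

section
/- For every natural number t ≥ 2 and every odd natural number g with 3 ≤ g ≤ t, there exists a finite connected simple graph G whose edge connectivity equals t and which admits a guarding set of cardinality g. -/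
open Relation in
/-- A path in a relation enlarged by the single pair `(y, x)` either avoids that pair or
decomposes into a path ending at `y` and a path starting at `x`. -/
theorem Relation.TransGen.of_or_pair {V : Type*} {R : V → V → Prop} {x y p q : V}
    (h : TransGen (fun a b => R a b ∨ (a = y ∧ b = x)) p q) :
    TransGen R p q ∨ (ReflTransGen R p y ∧ ReflTransGen R x q) := by
  induction h with
  | single h =>
    rcases h with h | ⟨rfl, rfl⟩
    · exact .inl (.single h)
    · exact .inr ⟨.refl, .refl⟩
  | tail _ h ih =>
    rcases ih with ih | ⟨h1, h2⟩ <;> rcases h with h | ⟨rfl, rfl⟩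
    · exact .inl (ih.tail h)
    · exact .inr ⟨ih.to_reflTransGen, .refl⟩
    · exact .inr ⟨h1, h2.tail h⟩
    · exact .inr ⟨h1, .refl⟩

namespace GraphOrientation

open Relation

variable {V : Type*} {G : SimpleGraph V} {O : GraphOrientation G}

/-- In an acyclic orientation, an edge that is not flippable is bypassed by a directed path. -/
theorem IsAcyclic.exists_bypass (hO : O.IsAcyclic) {x y : V} (hxy : O.dir x y)
    (h : ¬ O.Flippable x y) :
    ReflTransGen (fun a b => O.dir a b ∧ ¬(a = x ∧ b = y)) x y := by
  have h' : ∃ w, TransGen (O.flip x y) w w := by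
    by_contra! h'
    exact h ⟨hxy, h'⟩
  obtain ⟨w, hw⟩ := h'
  rcases TransGen.of_or_pair hw with h1 | ⟨h1, h2⟩
  · exact absurd (TransGen.mono (fun _ _ h => h.1) _ _ h1) (hO w)
  · exact h2.trans h1

theorem IsAcyclic.antisymm (hO : O.IsAcyclic) {x y : V} (h1 : ReflTransGen O.dir x y)
    (h2 : ReflTransGen O.dir y x) : x = y := by
  rcases reflTransGen_iff_eq_or_transGen.1 h1 with h | h
  · exact h.symm
  · exact absurd (h.trans_left h2) (hO x)

/-- Suppose that a vertex set `B` can only be left through the vertex `c`, or from `p` along the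
edges to `q` and `r`. Then a directed path from `p` to `q` bypassing the edge `pq`
passes through `c` or `r`. -/
theorem bypass_through {B : Set V} {c p q r : V} (hp : p ∈ B) (hq : q ∉ B)
    (hB : ∀ u ∈ B, ∀ v, G.Adj u v → v ∈ B ∨ v = c ∨ (u = p ∧ (v = q ∨ v = r)))
    (h : ReflTransGen (fun a b => O.dir a b ∧ ¬(a = p ∧ b = q)) p q) :
    (ReflTransGen O.dir p c ∧ ReflTransGen O.dir c q) ∨
      (ReflTransGen O.dir p r ∧ ReflTransGen O.dir r q) := by
  have key : ∀ v, ReflTransGen (fun a b => O.dir a b ∧ ¬(a = p ∧ b = q)) p v →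
      v ∈ B ∨ (ReflTransGen O.dir p c ∧ ReflTransGen O.dir c v) ∨
        (ReflTransGen O.dir p r ∧ ReflTransGen O.dir r v) := by
    intro v hv
    induction hv with
    | refl => exact .inl hp
    | @tail u v hu huv ih =>
      have hpv : ReflTransGen O.dir p v :=
        ReflTransGen.tail (ReflTransGen.mono (fun _ _ h => h.1) _ _ hu) huv.1
      rcases ih with ih | ⟨h1, h2⟩ | ⟨h1, h2⟩
      · rcases hB u ih v (O.dir_adj _ _ huv.1) with h | rfl | ⟨rfl, rfl | rfl⟩
        · exact .inl h
        · exact .inr (.inl ⟨hpv, .refl⟩)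
        · exact absurd ⟨rfl, rfl⟩ huv.2
        · exact .inr (.inr ⟨hpv, .refl⟩)
      · exact .inr (.inl ⟨h1, h2.tail huv.1⟩)
      · exact .inr (.inr ⟨h1, h2.tail huv.1⟩)
  exact (key q h).resolve_left hq

end GraphOrientation

namespace SimpleGraph

/-- If three vertex sets `B i` are attached to each other only through a common vertex `c` and a
triangle with one vertex in each of them, then the edges of the triangle form a guarding set. -/
theorem isGuarding_triangle {V : Type*} {G : SimpleGraph V} {c : V} {a : Fin 3 → V}
    {B : Fin 3 → Set V} (hc : ∀ i, c ≠ a i) (ha : ∀ i j, a i ∈ B j ↔ i = j)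
    (hadj : ∀ i j, i ≠ j → G.Adj (a i) (a j))
    (hB : ∀ i, ∀ u ∈ B i, ∀ v, G.Adj u v → v ∈ B i ∨ v = c ∨ (u = a i ∧ ∃ j, v = a j))
    {S : Set (Sym2 V)} (hS : ∀ i j, i ≠ j → s(a i, a j) ∈ S) : G.IsGuarding S := by
  intro O hO
  by_contra! hn
  have bypass : ∀ i j k : Fin 3, i ≠ j → j ≠ k → i ≠ k → O.dir (a i) (a j) →
      (Relation.ReflTransGen O.dir (a i) c ∧ Relation.ReflTransGen O.dir c (a j)) ∨
      (Relation.ReflTransGen O.dir (a i) (a k) ∧ Relation.ReflTransGen O.dir (a k) (a j)) := by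
    intro i j k hij hjk hik hd
    refine O.bypass_through ((ha i i).2 rfl) (fun h => hij ((ha j i).1 h).symm) ?_
      (hO.exists_bypass hd fun hf => hn _ _ hf (hS i j hij))
    intro u hu v huv
    rcases hB i u hu v huv with h | h | ⟨h, l, rfl⟩
    · exact .inl h
    · exact .inr (.inl h)
    · have hl : l = i ∨ l = j ∨ l = k := by omega
      rcases hl with rfl | rfl | rfl
      · exact .inl ((ha _ _).2 rfl)
      · exact .inr (.inr ⟨h, .inl rfl⟩)
      · exact .inr (.inr ⟨h, .inr rfl⟩)
  have key : ∀ i j k : Fin 3, i ≠ j → j ≠ k → i ≠ k → O.dir (a i) (a j) →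
      ¬ O.dir (a j) (a k) := by
    intro i j k hij hjk hik h1 h2
    have hcj : Relation.ReflTransGen O.dir c (a j) := by
      rcases bypass i j k hij hjk hik h1 with h | h
      · exact h.2
      · exact absurd (hO.antisymm h.2 (.single h2)) (hadj k j hjk.symm).ne
    have hjc : Relation.ReflTransGen O.dir (a j) c := by
      rcases bypass j k i hjk hik.symm hij.symm h2 with h | h
      · exact h.1
      · exact absurd (hO.antisymm h.1 (.single h1)) (hadj j i hij.symm).ne
    exact hc j (hO.antisymm hcj hjc)
  have h01 := O.dir_total _ _ (hadj 0 1 (by decide))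
  have h12 := O.dir_total _ _ (hadj 1 2 (by decide))
  have h02 := O.dir_total _ _ (hadj 0 2 (by decide))
  have k1 := key 0 1 2 (by decide) (by decide) (by decide)
  have k2 := key 2 1 0 (by decide) (by decide) (by decide)
  have k3 := key 1 0 2 (by decide) (by decide) (by decide)
  have k4 := key 2 0 1 (by decide) (by decide) (by decide)
  have k5 := key 0 2 1 (by decide) (by decide) (by decide)
  have k6 := key 1 2 0 (by decide) (by decide) (by decide)
  tauto

/-- Two vertices of a clique on `t + 1` vertices stay connected when fewer than `t` edges are
deleted. -/
theorem reachable_deleteEdges_of_clique {V ι : Type*} [Fintype ι] {G : SimpleGraph V} {c : V}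
    {f : ι → V} (hf : ∀ i j, i ≠ j → G.Adj (f i) (f j)) (hfc : ∀ i, G.Adj (f i) c)
    {C : Finset (Sym2 V)} (hC : C.card < Fintype.card ι) (k : ι) :
    (G.deleteEdges ↑C).Reachable (f k) c := by
  classical
  by_contra hn
  have hkc : s(f k, c) ∈ C := by
    by_contra h
    exact hn (Adj.reachable (by simpa [deleteEdges_adj] using ⟨hfc k, h⟩))
  have hor : ∀ i, i ≠ k → s(f k, f i) ∉ C → s(f i, c) ∈ C := by
    intro i hi h1
    by_contra h2
    have r1 : (G.deleteEdges ↑C).Adj (f k) (f i) := by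
      simpa [deleteEdges_adj] using ⟨hf k i hi.symm, h1⟩
    have r2 : (G.deleteEdges ↑C).Adj (f i) c := by
      simpa [deleteEdges_adj] using ⟨hfc i, h2⟩
    exact hn (r1.reachable.trans r2.reachable)
  let F : ι → Sym2 V := fun i =>
    if i = k then s(f k, c) else if s(f k, f i) ∈ C then s(f k, f i) else s(f i, c)
  have hmem : ∀ i ∈ Finset.univ, F i ∈ C := by
    intro i _
    dsimp only [F]
    split_ifs with h1 h2
    · exact hkc
    · exact h2
    · exact hor i h1 h2
  have hinj : Function.Injective f := by
    intro i j h
    by_contra hij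
    exact (hf i j hij).ne h
  have hFinj : Function.Injective F := by
    intro i j h
    have h1 := (hfc i).ne
    have h2 := (hfc j).ne
    have h3 := (hfc k).ne
    have h4 := @hinj i j
    have h5 := @hinj i k
    have h6 := @hinj j k
    dsimp only [F] at h
    split_ifs at h <;> simp only [Sym2.eq_iff] at h <;> grind
  have := Finset.card_le_card_of_injOn F hmem hFinj.injOn
  rw [Finset.card_univ] at this
  omega

/-- Three cliques on `t + 1` vertices sharing the vertex `none`, together with a triangle
on the vertices `some (i, 0)`. -/
def cliqueTriangle (t : ℕ) : SimpleGraph (Option (Fin 3 × Fin t)) where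
  Adj u v := u ≠ v ∧ ∀ p ∈ u, ∀ q ∈ v, p.1 = q.1 ∨ (p.2.val = 0 ∧ q.2.val = 0)
  symm := ⟨fun _ _ h => ⟨h.1.symm, fun p hp q hq =>
    (h.2 q hq p hp).imp Eq.symm And.symm⟩⟩
  loopless := ⟨fun _ h => h.1 rfl⟩

theorem cliqueTriangle_adj_some {t : ℕ} {p q : Fin 3 × Fin t} :
    (cliqueTriangle t).Adj (some p) (some q) ↔
      p ≠ q ∧ (p.1 = q.1 ∨ (p.2.val = 0 ∧ q.2.val = 0)) := by
  simp only [cliqueTriangle, Option.mem_some_iff, forall_eq', ne_eq, Option.some.injEq]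

theorem cliqueTriangle_adj_none {t : ℕ} {p : Fin 3 × Fin t} :
    (cliqueTriangle t).Adj (some p) none := by
  simp [cliqueTriangle]

end SimpleGraph

/-- For every natural number `t ≥ 2` and every odd natural number `g` with `3 ≤ g ≤ t`,
there exists a finite connected simple graph whose edge connectivity (the minimum
cardinality of a set of edges whose removal disconnects the graph) equals `t` and which
admits a guarding set of cardinality `g`. -/
theorem exists_graph_edgeConnectivity_with_small_guarding (t g : ℕ)
    (ht : 2 ≤ t) (hodd : Odd g) (hg3 : 3 ≤ g) (hgt : g ≤ t) :
    ∃ (n : ℕ) (G : SimpleGraph (Fin n)), G.Connected ∧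
      sInf {k : ℕ | ∃ C : Finset (Sym2 (Fin n)),
          ↑C ⊆ G.edgeSet ∧ ¬ (G.deleteEdges ↑C).Connected ∧ C.card = k} = t ∧
      ∃ S : Finset (Sym2 (Fin n)),
        ↑S ⊆ G.edgeSet ∧ G.IsGuarding ↑S ∧ S.card = g := by
  classical
  let e : Option (Fin 3 × Fin t) ≃ Fin (Fintype.card (Option (Fin 3 × Fin t))) :=
    Fintype.equivFin _
  let H := SimpleGraph.cliqueTriangle t
  let G : SimpleGraph (Fin (Fintype.card (Option (Fin 3 × Fin t)))) := H.comap e.symm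
  have adj : ∀ x y, G.Adj (e x) (e y) ↔ H.Adj x y := fun x y => by
    simp [G, SimpleGraph.comap_adj]
  have conn : ∀ C : Finset (Sym2 (Fin (Fintype.card (Option (Fin 3 × Fin t))))), C.card < t → (G.deleteEdges ↑C).Connected := by
    intro C hC
    have hr : ∀ v, (G.deleteEdges ↑C).Reachable v (e none) := by
      intro v
      obtain ⟨v, rfl⟩ := e.surjective v
      rcases v with _ | ⟨i, x⟩
      · exact .rfl
      · refine SimpleGraph.reachable_deleteEdges_of_clique
          (f := fun y : Fin t => e (some (i, y))) ?_ ?_ (by simpa using hC) x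
        · intro y z hyz
          simp [adj, H, SimpleGraph.cliqueTriangle_adj_some, hyz]
        · intro y
          simp [adj, H, SimpleGraph.cliqueTriangle_adj_none]
    exact (SimpleGraph.connected_iff _).2 ⟨fun u v => (hr u).trans (hr v).symm, ⟨e none⟩⟩
  let w := e (some (0, ⟨1, by omega⟩))
  have hdeg : G.degree w = t := by
    have hN : G.neighborFinset w =
        ((Finset.univ.erase (⟨1, by omega⟩ : Fin t)).image fun x => e (some (0, x))) ∪
          {e none} := by
      ext v
      obtain ⟨v, rfl⟩ := e.surjective v
      rcases v with _ | ⟨i, x⟩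
      · simp [w, adj, H, SimpleGraph.cliqueTriangle_adj_none]
      · simp only [SimpleGraph.mem_neighborFinset, w, adj, H,
          SimpleGraph.cliqueTriangle_adj_some]
        simp
        grind
    rw [← SimpleGraph.card_neighborFinset_eq_degree, hN, Finset.card_union_of_disjoint,
      Finset.card_image_of_injective, Finset.card_erase_of_mem (Finset.mem_univ _)]
    · simp
      omega
    · intro x y h
      simpa using h
    · simp
  refine ⟨_, G, ?_, ?_, ?_⟩
  · simpa using conn ∅ (by simpa using by omega)
  · refine IsLeast.csInf_eq ⟨⟨G.incidenceFinset w, ?_, ?_, ?_⟩, ?_⟩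
    · simpa using G.incidenceSet_subset w
    · intro h
      have hne : w ≠ e none := by simp [w]
      have : Nontrivial (Fin (Fintype.card (Option (Fin 3 × Fin t)))) := ⟨⟨_, _, hne⟩⟩
      obtain ⟨v, hv⟩ := h.preconnected.exists_adj_of_nontrivial w
      rw [SimpleGraph.deleteEdges_adj] at hv
      exact hv.2 (by simpa [SimpleGraph.mem_incidenceSet] using hv.1)
    · rw [SimpleGraph.card_incidenceFinset_eq_degree, hdeg]
    · rintro k ⟨C, -, hC, rfl⟩
      by_contra! h
      exact hC (conn C h)
  · let a : Fin 3 → Fin (Fintype.card (Option (Fin 3 × Fin t))) :=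
      fun i => e (some (i, ⟨0, by omega⟩))
    have hadj : ∀ i j, i ≠ j → G.Adj (a i) (a j) := fun i j hij => by
      simp [a, adj, H, SimpleGraph.cliqueTriangle_adj_some, hij]
    let S₀ : Finset (Sym2 (Fin (Fintype.card (Option (Fin 3 × Fin t))))) :=
      {s(a 0, a 1), s(a 1, a 2), s(a 2, a 0)}
    have hS₀ : S₀ ⊆ G.edgeFinset := by
      intro x hx
      simp only [S₀, Finset.mem_insert, Finset.mem_singleton] at hx
      rcases hx with rfl | rfl | rfl <;>
        simpa using hadj _ _ (by decide)
    have hcard : g ≤ G.edgeFinset.card := by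
      refine hgt.trans (hdeg.ge.trans ?_)
      rw [← SimpleGraph.card_incidenceFinset_eq_degree]
      exact Finset.card_le_card (G.incidenceFinset_subset w)
    obtain ⟨S, hS₀S, hSG, hSg⟩ :=
      Finset.exists_subsuperset_card_eq hS₀ (Finset.card_le_three.trans hg3) hcard
    refine ⟨S, by simpa using Finset.coe_subset.2 hSG, ?_, hSg⟩
    refine SimpleGraph.isGuarding_triangle (c := e none) (a := a)
      (B := fun i => {v | ∃ x, v = e (some (i, x))}) ?_ ?_ hadj ?_ ?_
    · simp [a]
    · intro i j
      simp [a]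
    · rintro i _ ⟨x, rfl⟩ v huv
      obtain ⟨v, rfl⟩ := e.surjective v
      rcases v with _ | ⟨j, y⟩
      · exact .inr (.inl rfl)
      · rw [adj, SimpleGraph.cliqueTriangle_adj_some] at huv
        rcases huv.2 with h | ⟨h1, h2⟩
        · exact .inl ⟨y, by simp at h; simp [h]⟩
        · refine .inr (.inr ⟨?_, j, ?_⟩) <;> simp [a, Fin.ext_iff] <;> assumption
    · intro i j hij
      have h01 : s(a 0, a 1) ∈ S := hS₀S (by simp [S₀])
      have h12 : s(a 1, a 2) ∈ S := hS₀S (by simp [S₀])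
      have h20 : s(a 2, a 0) ∈ S := hS₀S (by simp [S₀])
      fin_cases i <;> fin_cases j <;>
        first
        | exact absurd rfl hij
        | assumption
        | (rw [Sym2.eq_swap]; assumption)
end

section
/- Let G be a finite simple graph on vertex set {v_1, …, v_n}, and let G' be the graph obtained from G by adding a new apex vertex x adjacent to all of v_1, …, v_n and subdividing every edge of G once (so every edge v_i v_j of G is replaced by a path v_i — w_{ij} — v_j through a new vertex w_{ij}). Define a labeling of the vertices of G' by elements of {0,1}^n as follows: x is labeled by the all-zeros word, v_i by the standard basis vector e_i, and w_{ij} by e_i + e_j. Then this labeling is an isometric embedding of G' into the hypercube Q_n: for any two vertices of G', their graph distance in G' equals the Hamming distance between their labels. In particular, G' is a partial cube. -/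
open SimpleGraph

/-- The graph `G'` obtained from a graph `G` on vertex set `Fin n` by adding an apex
vertex `x` (encoded as `none`) adjacent to every original vertex `vᵢ` (encoded as
`some (Sum.inl i)`) and subdividing every edge `e` of `G` once through a new vertex
`w_e` (encoded as `some (Sum.inr e)`). -/
def apexSubdiv (n : ℕ) (G : SimpleGraph (Fin n)) :
    SimpleGraph (Option (Fin n ⊕ ↥G.edgeSet)) :=
  SimpleGraph.fromRel (fun a b =>
    (a = none ∧ ∃ i : Fin n, b = some (Sum.inl i)) ∨
    (∃ (i : Fin n) (e : ↥G.edgeSet), a = some (Sum.inl i) ∧ b = some (Sum.inr e) ∧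
      i ∈ (e : Sym2 (Fin n))))

/-- The labeling of the vertices of `G'` by words in `{0,1}^n`: the apex `x` gets the
all-zeros word, `vᵢ` gets the standard basis vector `eᵢ`, and the subdivision vertex of
an edge `{i,j}` gets `eᵢ + eⱼ`. -/
def apexLabel (n : ℕ) (G : SimpleGraph (Fin n)) :
    Option (Fin n ⊕ ↥G.edgeSet) → Fin n → Bool
  | none => fun _ => false
  | some (Sum.inl i) => fun k => decide (k = i)
  | some (Sum.inr e) => fun k => decide (k ∈ (e : Sym2 (Fin n)))

theorem apexLabel_injective (n : ℕ) (G : SimpleGraph (Fin n)) :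
    Function.Injective (apexLabel n G) := by
  rintro (_ | i | ⟨e, he⟩) (_ | j | ⟨f, hf⟩) h
  · rfl
  · simpa [apexLabel] using congrFun h j
  · induction f with | _ u v => simpa [apexLabel] using congrFun h u
  · simpa [apexLabel] using congrFun h i
  · simpa [apexLabel] using congrFun h i
  · induction f with | _ u v =>
    have hu := congrFun h u
    have hv := congrFun h v
    have hne : u ≠ v := G.ne_of_adj hf
    simp [apexLabel] at hu hv
    exact absurd (hu.trans hv.symm) hne
  · induction e with | _ u v => simpa [apexLabel] using congrFun h u
  · induction e with | _ u v =>
    have hu := congrFun h u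
    have hv := congrFun h v
    have hne : u ≠ v := G.ne_of_adj he
    simp [apexLabel] at hu hv
    exact absurd (hu.trans hv.symm) hne
  · have hef : e = f := Sym2.ext fun k => by simpa [apexLabel] using congrFun h k
    subst hef
    rfl

theorem exists_adj_apexLabel_eq_update {n : ℕ} {G : SimpleGraph (Fin n)}
    (a : Option (Fin n ⊕ ↥G.edgeSet)) (k : Fin n) (hk : apexLabel n G a k = true) :
    ∃ c, (apexSubdiv n G).Adj a c ∧
      apexLabel n G c = Function.update (apexLabel n G a) k false := by
  rcases a with _ | i | ⟨e, he⟩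
  · simp [apexLabel] at hk
  · obtain rfl : k = i := by simpa [apexLabel] using hk
    refine ⟨none, by simp [apexSubdiv], ?_⟩
    funext l
    by_cases hl : l = k <;> simp [apexLabel, hl]
  · have hke : k ∈ e := by simpa [apexLabel] using hk
    obtain ⟨j, rfl⟩ := hke
    have hne : k ≠ j := G.ne_of_adj he
    refine ⟨some (Sum.inl j), by simpa [apexSubdiv] using he, ?_⟩
    funext l
    by_cases hl : l = k
    · subst hl
      simp [apexLabel, hne]
    · simp [apexLabel, hl]

theorem hammingDist_update_not {ι : Type*} [Fintype ι] [DecidableEq ι]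
    (f : ι → Bool) (k : ι) : hammingDist f (Function.update f k (!f k)) = 1 := by
  rw [hammingDist, Finset.card_eq_one]
  refine ⟨k, Finset.ext fun l => ?_⟩
  by_cases hl : l = k
  · subst hl
    simp
  · simp [hl]

theorem hammingDist_update_add_one {ι : Type*} [Fintype ι] [DecidableEq ι]
    {f g : ι → Bool} {k : ι} (h : f k ≠ g k) :
    hammingDist (Function.update f k (g k)) g + 1 = hammingDist f g := by
  have hs : (Finset.univ.filter fun l => f l ≠ g l) =
      insert k (Finset.univ.filter fun l => Function.update f k (g k) l ≠ g l) := by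
    ext l
    by_cases hl : l = k
    · subst hl
      simp [h]
    · simp [hl]
  rw [hammingDist, hammingDist, hs, Finset.card_insert_of_notMem (by simp)]

theorem apexLabel_eq_update_of_adj {n : ℕ} {G : SimpleGraph (Fin n)}
    {a b : Option (Fin n ⊕ ↥G.edgeSet)} (h : (apexSubdiv n G).Adj a b) :
    (∃ k, apexLabel n G b = Function.update (apexLabel n G a) k (!apexLabel n G a k)) ∨
    (∃ k, apexLabel n G a = Function.update (apexLabel n G b) k (!apexLabel n G b k)) := by
  have key : ∀ a b : Option (Fin n ⊕ ↥G.edgeSet),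
      ((a = none ∧ ∃ i : Fin n, b = some (Sum.inl i)) ∨
        (∃ (i : Fin n) (e : ↥G.edgeSet), a = some (Sum.inl i) ∧ b = some (Sum.inr e) ∧
          i ∈ (e : Sym2 (Fin n)))) →
      ∃ k, apexLabel n G b = Function.update (apexLabel n G a) k (!apexLabel n G a k) := by
    rintro a b (⟨rfl, i, rfl⟩ | ⟨i, ⟨e, he⟩, rfl, rfl, j, rfl⟩)
    · refine ⟨i, funext fun l => ?_⟩
      by_cases hl : l = i <;> simp [apexLabel, hl]
    · have hne : i ≠ j := G.ne_of_adj he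
      refine ⟨j, funext fun l => ?_⟩
      by_cases hl : l = j
      · subst hl
        simp [apexLabel, hne.symm]
      · simp [apexLabel, hl]
  exact ((SimpleGraph.fromRel_adj _ _ _).1 h).2.imp (key a b) (key b a)

theorem hammingDist_apexLabel_of_adj {n : ℕ} {G : SimpleGraph (Fin n)}
    {a b : Option (Fin n ⊕ ↥G.edgeSet)} (h : (apexSubdiv n G).Adj a b) :
    hammingDist (apexLabel n G a) (apexLabel n G b) = 1 := by
  obtain ⟨k, hk⟩ | ⟨k, hk⟩ := apexLabel_eq_update_of_adj h
  · rw [hk, hammingDist_update_not]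
  · rw [hk, hammingDist_comm, hammingDist_update_not]

theorem hammingDist_apexLabel_le_length {n : ℕ} {G : SimpleGraph (Fin n)}
    {a b : Option (Fin n ⊕ ↥G.edgeSet)} (p : (apexSubdiv n G).Walk a b) :
    hammingDist (apexLabel n G a) (apexLabel n G b) ≤ p.length := by
  induction p with
  | nil => simp
  | @cons u v w h p ih =>
    have := hammingDist_triangle (apexLabel n G u) (apexLabel n G v) (apexLabel n G w)
    rw [hammingDist_apexLabel_of_adj h] at this
    rw [SimpleGraph.Walk.length_cons]
    omega

theorem exists_walk_length_eq_hammingDist {n : ℕ} {G : SimpleGraph (Fin n)}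
    (a b : Option (Fin n ⊕ ↥G.edgeSet)) :
    ∃ p : (apexSubdiv n G).Walk a b,
      p.length = hammingDist (apexLabel n G a) (apexLabel n G b) := by
  induction hd : hammingDist (apexLabel n G a) (apexLabel n G b) generalizing a b with
  | zero =>
    obtain rfl := apexLabel_injective n G (hammingDist_eq_zero.1 hd)
    exact ⟨.nil, rfl⟩
  | succ d ih =>
    have step : ∀ (a b : Option (Fin n ⊕ ↥G.edgeSet)) (k : Fin n),
        hammingDist (apexLabel n G a) (apexLabel n G b) = d + 1 →
        apexLabel n G a k = true → apexLabel n G b k = false →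
        ∃ p : (apexSubdiv n G).Walk a b, p.length = d + 1 := by
      intro a b k hd ha hb
      obtain ⟨c, hac, hc⟩ := exists_adj_apexLabel_eq_update a k ha
      have hcb := hammingDist_update_add_one
        (f := apexLabel n G a) (g := apexLabel n G b) (k := k) (by simp [ha, hb])
      rw [hb, ← hc, hd] at hcb
      obtain ⟨p, hp⟩ := ih c b (Nat.succ.inj hcb)
      exact ⟨.cons hac p, by simp [hp]⟩
    obtain ⟨k, hk⟩ : ∃ k, apexLabel n G a k ≠ apexLabel n G b k :=
      Function.ne_iff.1 (hammingDist_ne_zero.1 (by omega))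
    cases ha : apexLabel n G a k with
    | true => exact step a b k hd ha (by simpa [ha] using hk)
    | false =>
      obtain ⟨p, hp⟩ := step b a k (by rwa [hammingDist_comm]) (by simpa [ha] using hk) ha
      exact ⟨p.reverse, by simpa using hp⟩

/-- The labeling `apexLabel` is an isometric embedding of `G'` into the hypercube `Qₙ`:
it is injective, the graph distance in `G'` of any two vertices equals the Hamming
distance of their labels, and adjacent vertices get labels at Hamming distance 1.
In particular `G'` is a partial cube. -/
theorem apexSubdiv_isometric_embedding (n : ℕ) (G : SimpleGraph (Fin n)) :
    Function.Injective (apexLabel n G) ∧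
    (∀ a b, (apexSubdiv n G).dist a b = hammingDist (apexLabel n G a) (apexLabel n G b)) ∧
    (∀ a b, (apexSubdiv n G).Adj a b →
      hammingDist (apexLabel n G a) (apexLabel n G b) = 1) := by
  refine ⟨apexLabel_injective n G, fun a b => ?_, fun a b => hammingDist_apexLabel_of_adj⟩
  obtain ⟨p, hp⟩ := exists_walk_length_eq_hammingDist a b
  obtain ⟨q, hq⟩ := p.reachable.exists_walk_length_eq_dist
  exact le_antisymm (hp ▸ SimpleGraph.dist_le p) (hq ▸ hammingDist_apexLabel_le_length q)
end

section
/- Let G be a finite simple graph on vertex set {v_1, …, v_n} with no isolated vertices, and let G' be the graph obtained from G by adding a new apex vertex x adjacent to all of v_1, …, v_n and subdividing every edge of G once (so every edge v_i v_j of G is replaced by a path v_i — w_{ij} — v_j through a new vertex w_{ij}). For each i, define the zone of v_i to be the set of edges of G' consisting of the edge x v_i together with all edges w_{ij} v_j over edges v_i v_j of G. Say that a set S ⊆ {v_1,…,v_n} covers G' if every vertex of G' is incident to at least one edge belonging to the zone of some vertex in S. Then the minimum cardinality of a set S covering G' equals the minimum cardinality of a vertex cover of G. -/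
open SimpleGraph

/-- The zone of an original vertex `vᵢ` in `G'`: it consists of the edge `x vᵢ` together
with all edges `w_{ij} vⱼ` for edges `{i,j}` of `G` (where `vⱼ` is the *other* endpoint). -/
def apexZone (n : ℕ) (G : SimpleGraph (Fin n)) (i : Fin n) :
    Set (Sym2 (Option (Fin n ⊕ ↥G.edgeSet))) :=
  {p | p = s(none, some (Sum.inl i)) ∨
    ∃ (e : ↥G.edgeSet) (j : Fin n), p = s(some (Sum.inr e), some (Sum.inl j)) ∧
      i ∈ (e : Sym2 (Fin n)) ∧ j ∈ (e : Sym2 (Fin n)) ∧ j ≠ i}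

/-- `S` covers `G'` if every vertex of `G'` is incident to at least one edge belonging
to the zone of some vertex of `S`. -/
def ZoneCovers (n : ℕ) (G : SimpleGraph (Fin n)) (S : Finset (Fin n)) : Prop :=
  ∀ a : Option (Fin n ⊕ ↥G.edgeSet), ∃ i ∈ S, ∃ p ∈ apexZone n G i, a ∈ p

theorem mem_of_zoneCovers {n : ℕ} {G : SimpleGraph (Fin n)} {S : Finset (Fin n)}
    (hS : ZoneCovers n G S) {a b : Fin n} (hab : G.Adj a b) : a ∈ S ∨ b ∈ S := by
  obtain ⟨i, hi, p, rfl | ⟨e, j, rfl, hie, -, -⟩, ha⟩ := hS (some (Sum.inr ⟨s(a, b), hab⟩))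
  · simp at ha
  · obtain rfl : ⟨s(a, b), hab⟩ = e := by simpa using ha
    rcases Sym2.mem_iff.1 hie with rfl | rfl
    · exact Or.inl hi
    · exact Or.inr hi

theorem zoneCovers_of_vertexCover {n : ℕ} (hn : 0 < n) {G : SimpleGraph (Fin n)}
    (hiso : ∀ i : Fin n, ∃ j, G.Adj i j) {T : Finset (Fin n)}
    (hT : ∀ a b, G.Adj a b → a ∈ T ∨ b ∈ T) : ZoneCovers n G T := by
  rintro (_ | k | ⟨e, he⟩)
  · obtain ⟨j, hj⟩ := hiso ⟨0, hn⟩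
    obtain h | h := hT _ _ hj
    · exact ⟨_, h, _, Or.inl rfl, Sym2.mem_mk_left _ _⟩
    · exact ⟨_, h, _, Or.inl rfl, Sym2.mem_mk_left _ _⟩
  · obtain ⟨j, hj⟩ := hiso k
    obtain h | h := hT _ _ hj
    · exact ⟨_, h, _, Or.inl rfl, Sym2.mem_mk_right _ _⟩
    · exact ⟨j, h, _, Or.inr ⟨⟨s(k, j), hj⟩, k, rfl, Sym2.mem_mk_right _ _,
        Sym2.mem_mk_left _ _, hj.ne⟩, Sym2.mem_mk_right _ _⟩
  · induction e with | _ a b => ?_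
    have hab : G.Adj a b := he
    obtain h | h := hT _ _ hab
    · exact ⟨a, h, _, Or.inr ⟨⟨s(a, b), he⟩, b, rfl, Sym2.mem_mk_left _ _,
        Sym2.mem_mk_right _ _, hab.ne'⟩, Sym2.mem_mk_left _ _⟩
    · exact ⟨b, h, _, Or.inr ⟨⟨s(a, b), he⟩, a, rfl, Sym2.mem_mk_right _ _,
        Sym2.mem_mk_left _ _, hab.ne⟩, Sym2.mem_mk_left _ _⟩

/-- If `G` has no isolated vertices, then the minimum cardinality of a set of (zones of)
original vertices covering all vertices of `G'` equals the minimum cardinality of a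
vertex cover of `G`. -/
theorem min_zone_cover_eq_min_vertex_cover (n : ℕ) (G : SimpleGraph (Fin n))
    (hiso : ∀ i : Fin n, ∃ j, G.Adj i j) :
    sInf {k : ℕ | ∃ S : Finset (Fin n), ZoneCovers n G S ∧ S.card = k} =
      sInf {k : ℕ | ∃ T : Finset (Fin n),
        (∀ a b, G.Adj a b → a ∈ T ∨ b ∈ T) ∧ T.card = k} := by
  obtain rfl | hn := n.eq_zero_or_pos
  · have hempty : {k : ℕ | ∃ S : Finset (Fin 0), ZoneCovers 0 G S ∧ S.card = k} = ∅ := by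
      ext k
      simp only [Set.mem_ofPred_eq, Set.mem_empty_iff_false, iff_false]
      rintro ⟨S, hS, -⟩
      obtain ⟨i, -⟩ := hS none
      exact i.elim0
    rw [hempty, Nat.sInf_empty]
    refine (Nat.sInf_eq_zero.2 (Or.inl ?_)).symm
    exact ⟨∅, fun a => a.elim0, rfl⟩
  · have hiff (S : Finset (Fin n)) :
        ZoneCovers n G S ↔ ∀ a b, G.Adj a b → a ∈ S ∨ b ∈ S :=
      ⟨fun h _ _ => mem_of_zoneCovers h, zoneCovers_of_vertexCover hn hiso⟩
    simp only [hiff]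
end

section
/- Let P = (V, ≤) be a finite poset and let D ⊆ V be a downset of P. Let F = V \ D, let A be the set of maximal elements of D, let B be the set of minimal elements of F, and let B' = { b ∈ B : b is incomparable to every element of A }. Then A ∪ B' is a maximal antichain of P. -/
/-- A maximal antichain: an antichain not properly contained in any other antichain. -/
def IsMaxAntichainSet {V : Type*} [PartialOrder V] (A : Set V) : Prop :=
  IsAntichain (· ≤ ·) A ∧ ∀ B : Set V, IsAntichain (· ≤ ·) B → A ⊆ B → A = B

/-- Let `D` be a downset of a finite poset, `F = V \ D`, `A` the maximal elements of
`D`, `B` the minimal elements of `F`, and `B'` the elements of `B` incomparable to every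
element of `A`.  Then `A ∪ B'` is a maximal antichain. -/
theorem max_down_union_incomparable_min_up_isMaxAntichain
    {V : Type*} [Fintype V] [PartialOrder V] (D : Set V) (hD : IsLowerSet D) :
    IsMaxAntichainSet
      ({a ∈ D | ∀ x ∈ D, a ≤ x → x = a} ∪
       {b ∈ Dᶜ | (∀ y ∈ Dᶜ, y ≤ b → y = b) ∧
         ∀ a ∈ {a ∈ D | ∀ x ∈ D, a ≤ x → x = a}, ¬ a ≤ b ∧ ¬ b ≤ a}) := by
  refine ⟨?_, fun C hC hsub => hsub.antisymm fun x hx => ?_⟩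
  · rintro x (⟨hxD, hx⟩ | ⟨hxD, hx, hxA⟩) y (⟨hyD, hy⟩ | ⟨hyD, hy, hyA⟩) hne hle
    · exact hne (hx y hyD hle).symm
    · exact (hyA x ⟨hxD, hx⟩).1 hle
    · exact hxD (hD hle hyD)
    · exact hne (hy x hxD hle)
  · by_cases hxD : x ∈ D
    · obtain ⟨a, hxa, haD, ha⟩ := exists_maximal_ge_of_wellFoundedGT (· ∈ D) x hxD
      have haA : a ∈ {a ∈ D | ∀ x ∈ D, a ≤ x → x = a} :=
        ⟨haD, fun y hy hay => (ha hy hay).antisymm hay⟩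
      rw [hC.eq hx (hsub (Or.inl haA)) hxa]
      exact Or.inl haA
    · obtain ⟨b, hbx, hbD, hb⟩ := exists_minimal_le_of_wellFoundedLT (· ∈ Dᶜ) x hxD
      have hbB : ∀ y ∈ Dᶜ, y ≤ b → y = b := fun y hy hyb => hyb.antisymm (hb hy hyb)
      have hbA : ∀ a ∈ {a ∈ D | ∀ x ∈ D, a ≤ x → x = a}, ¬ a ≤ b ∧ ¬ b ≤ a := by
        refine fun a ha => ⟨fun hab => hxD ?_, fun hba => hbD (hD hba ha.1)⟩
        rw [← hC.eq (hsub (Or.inl ha)) hx (hab.trans hbx)]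
        exact ha.1
      rw [← hC.eq (hsub (Or.inr ⟨hbD, hbB, hbA⟩)) hx hbx]
      exact Or.inr ⟨hbD, hbB, hbA⟩
end
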